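/- On ℝ² with the Euclidean cometric g, the Poisson bivector Π ∂₁∧∂₂ and the associated contravariant Levi-Civita connection D with curvature R, the curvature 4-tensor satisfies the pair symmetry g(R(ω,τ)γ, δ) = g(R(γ,δ)ω, τ) for all smooth 1-forms ω, τ, γ, δ; in particular g(R(α,η)η, α) = g(R(η,α)α, η). -/

import Mathlib

noncomputable section

/-- Smooth scalar functions on `ℝ²`. -/
abbrev Fn : Type := (ℝ × ℝ) → ℝ

/-- A 1-form on `ℝ²` identified with its pair of component functions. -/
abbrev OneForm : Type := Fn × Fn

/-- Partial derivative in the first coordinate direction. -/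
def pd1 (f : Fn) : Fn := fun p => fderiv ℝ f p (1, 0)

/-- Partial derivative in the second coordinate direction. -/
def pd2 (f : Fn) : Fn := fun p => fderiv ℝ f p (0, 1)

/-- Smoothness of a function. -/
def SmoothFn (f : Fn) : Prop := ContDiff ℝ (⊤ : ℕ∞) f

/-- Smoothness of a 1-form. -/
def SmoothForm (ω : OneForm) : Prop := SmoothFn ω.1 ∧ SmoothFn ω.2

/-- The Euclidean cometric on 1-forms. -/
def gmet (ω τ : OneForm) : Fn := fun p => ω.1 p * τ.1 p + ω.2 p * τ.2 p

/-- The sharp map `♯(ω)` acting on a function. -/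
def sharpF (Pi : Fn) (ω : OneForm) (f : Fn) : Fn :=
  fun p => Pi p * (ω.1 p * pd2 f p - ω.2 p * pd1 f p)

/-- The contravariant Levi-Civita connection associated with `(g, Π)`. -/
def Dconn (Pi : Fn) (ω τ : OneForm) : OneForm :=
  (fun p => sharpF Pi ω τ.1 p + (ω.1 p * pd1 Pi p + ω.2 p * pd2 Pi p) * τ.2 p,
   fun p => sharpF Pi ω τ.2 p - (ω.1 p * pd1 Pi p + ω.2 p * pd2 Pi p) * τ.1 p)

/-- The sharp map as a vector field `(X¹, X²)`. -/
def sharpVF (Pi : Fn) (ω : OneForm) : Fn × Fn :=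
  (fun p => -(Pi p) * ω.2 p, fun p => Pi p * ω.1 p)

/-- Lie derivative of a 1-form along a vector field. -/
def lieVF (X : Fn × Fn) (τ : OneForm) : OneForm :=
  (fun p => X.1 p * pd1 τ.1 p + X.2 p * pd2 τ.1 p + τ.1 p * pd1 X.1 p + τ.2 p * pd1 X.2 p,
   fun p => X.1 p * pd1 τ.2 p + X.2 p * pd2 τ.2 p + τ.1 p * pd2 X.1 p + τ.2 p * pd2 X.2 p)

/-- The bivector evaluated on two 1-forms: `Π(ω,τ) = Π·(ω₁τ₂ − ω₂τ₁)`. -/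
def PiForm (Pi : Fn) (ω τ : OneForm) : Fn :=
  fun p => Pi p * (ω.1 p * τ.2 p - ω.2 p * τ.1 p)

/-- The exterior differential of a function, as a 1-form. -/
def dF (f : Fn) : OneForm := (pd1 f, pd2 f)

/-- The Koszul bracket of 1-forms. -/
def koszul (Pi : Fn) (ω τ : OneForm) : OneForm :=
  lieVF (sharpVF Pi ω) τ - lieVF (sharpVF Pi τ) ω - dF (PiForm Pi ω τ)

/-- Lie derivative of the cometric `g` along a 1-form `η`. -/
def lieG (Pi : Fn) (η α β : OneForm) : Fn :=
  fun p => sharpF Pi η (gmet α β) p - gmet (koszul Pi η α) β p - gmet α (koszul Pi η β) p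

/-- Second Lie derivative `(L_η (L_η g))(α, β)`. -/
def lie2G (Pi : Fn) (η α β : OneForm) : Fn :=
  fun p => sharpF Pi η (lieG Pi η α β) p - lieG Pi η (koszul Pi η α) β p
    - lieG Pi η α (koszul Pi η β) p

/-- `η` is a Killing 1-form. -/
def IsKilling (Pi : Fn) (η : OneForm) : Prop :=
  ∀ α β : OneForm, SmoothForm α → SmoothForm β → lieG Pi η α β = 0

/-- `η` is a 2-Killing 1-form. -/
def Is2Killing (Pi : Fn) (η : OneForm) : Prop :=
  ∀ α β : OneForm, SmoothForm α → SmoothForm β → lie2G Pi η α β = 0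

/-- Curvature of the contravariant connection. -/
def curv (Pi : Fn) (ω τ γ : OneForm) : OneForm :=
  Dconn Pi ω (Dconn Pi τ γ) - Dconn Pi τ (Dconn Pi ω γ) - Dconn Pi (koszul Pi ω τ) γ

/-- The coordinate 1-form `dx¹`. -/
def dx1 : OneForm := (fun _ => 1, fun _ => 0)

/-- The coordinate 1-form `dx²`. -/
def dx2 : OneForm := (fun _ => 0, fun _ => 1)

/-- Contravariant Laplacian on functions. -/
def lapF (Pi : Fn) (f : Fn) : Fn :=
  fun p => -((sharpF Pi dx1 (sharpF Pi dx1 f) p - sharpF Pi (Dconn Pi dx1 dx1) f p)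
    + (sharpF Pi dx2 (sharpF Pi dx2 f) p - sharpF Pi (Dconn Pi dx2 dx2) f p))

/-- Contravariant Laplacian on 1-forms. -/
def lapO (Pi : Fn) (η : OneForm) : OneForm :=
  -((Dconn Pi dx1 (Dconn Pi dx1 η) - Dconn Pi (Dconn Pi dx1 dx1) η)
    + (Dconn Pi dx2 (Dconn Pi dx2 η) - Dconn Pi (Dconn Pi dx2 dx2) η))

theorem SmoothFn.differentiable {f : Fn} (hf : SmoothFn f) : Differentiable ℝ f :=
  ContDiff.differentiable hf (by simp)

theorem SmoothFn.fderiv_apply {f : Fn} (hf : SmoothFn f) (v : ℝ × ℝ) :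
    SmoothFn fun p => fderiv ℝ f p v :=
  (ContDiff.fderiv_right (m := (⊤ : ℕ∞)) hf (by simp)).clm_apply contDiff_const

theorem SmoothFn.pd1 {f : Fn} (hf : SmoothFn f) : SmoothFn (pd1 f) := hf.fderiv_apply _

theorem SmoothFn.pd2 {f : Fn} (hf : SmoothFn f) : SmoothFn (pd2 f) := hf.fderiv_apply _

/-- Partial derivatives of a smooth function commute. -/
theorem SmoothFn.pd2_pd1 {f : Fn} (hf : SmoothFn f) (p : ℝ × ℝ) :
    _root_.pd2 (_root_.pd1 f) p = _root_.pd1 (_root_.pd2 f) p := by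
  have hd : DifferentiableAt ℝ (fderiv ℝ f) p :=
    ((ContDiff.fderiv_right (m := (⊤ : ℕ∞)) hf (by simp)).differentiable
      (by simp)).differentiableAt
  have hs : IsSymmSndFDerivAt ℝ f p :=
    (ContDiff.contDiffAt hf).isSymmSndFDerivAt
      (by rw [minSmoothness_of_isRCLikeNormedField]; exact WithTop.coe_le_coe.mpr le_top)
  unfold _root_.pd2 _root_.pd1
  rw [fderiv_clm_apply hd (by fun_prop), fderiv_clm_apply hd (by fun_prop)]
  simpa using hs (0, 1) (1, 0)

theorem SmoothFn.add {f g : Fn} (hf : SmoothFn f) (hg : SmoothFn g) :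
    SmoothFn fun q => f q + g q :=
  ContDiff.add hf hg

theorem SmoothFn.sub {f g : Fn} (hf : SmoothFn f) (hg : SmoothFn g) :
    SmoothFn fun q => f q - g q :=
  ContDiff.sub hf hg

theorem SmoothFn.mul {f g : Fn} (hf : SmoothFn f) (hg : SmoothFn g) :
    SmoothFn fun q => f q * g q :=
  ContDiff.mul hf hg

theorem SmoothFn.neg {f : Fn} (hf : SmoothFn f) : SmoothFn fun q => -f q :=
  ContDiff.neg hf

theorem pd1_add {f g : Fn} (hf : SmoothFn f) (hg : SmoothFn g)
    (p : ℝ × ℝ) : pd1 (fun q => f q + g q) p = pd1 f p + pd1 g p := by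
  simp [pd1, fderiv_fun_add (hf.differentiable p) (hg.differentiable p)]

theorem pd1_sub {f g : Fn} (hf : SmoothFn f) (hg : SmoothFn g)
    (p : ℝ × ℝ) : pd1 (fun q => f q - g q) p = pd1 f p - pd1 g p := by
  simp [pd1, fderiv_fun_sub (hf.differentiable p) (hg.differentiable p)]

theorem pd1_neg {f : Fn} (p : ℝ × ℝ) : pd1 (fun q => -f q) p = -pd1 f p := by
  simp [pd1, fderiv_fun_neg]

theorem pd1_mul {f g : Fn} (hf : SmoothFn f) (hg : SmoothFn g) (p : ℝ × ℝ) :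
    pd1 (fun q => f q * g q) p = pd1 f p * g p + f p * pd1 g p := by
  simp [pd1, fderiv_fun_mul (hf.differentiable p) (hg.differentiable p)]
  ring

theorem pd2_add {f g : Fn} (hf : SmoothFn f) (hg : SmoothFn g)
    (p : ℝ × ℝ) : pd2 (fun q => f q + g q) p = pd2 f p + pd2 g p := by
  simp [pd2, fderiv_fun_add (hf.differentiable p) (hg.differentiable p)]

theorem pd2_sub {f g : Fn} (hf : SmoothFn f) (hg : SmoothFn g)
    (p : ℝ × ℝ) : pd2 (fun q => f q - g q) p = pd2 f p - pd2 g p := by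
  simp [pd2, fderiv_fun_sub (hf.differentiable p) (hg.differentiable p)]

theorem pd2_neg {f : Fn} (p : ℝ × ℝ) : pd2 (fun q => -f q) p = -pd2 f p := by
  simp [pd2, fderiv_fun_neg]

theorem pd2_mul {f g : Fn} (hf : SmoothFn f) (hg : SmoothFn g) (p : ℝ × ℝ) :
    pd2 (fun q => f q * g q) p = pd2 f p * g p + f p * pd2 g p := by
  simp [pd2, fderiv_fun_mul (hf.differentiable p) (hg.differentiable p)]
  ring

/-- The sectional curvature of `D`: `Π ΔΠ - |dΠ|²`. -/
def sectional (Pi : Fn) : Fn := fun p =>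
  Pi p * (pd1 (pd1 Pi) p + pd2 (pd2 Pi) p) - (pd1 Pi p ^ 2 + pd2 Pi p ^ 2)

/-- The curvature is the sectional curvature times `ω ∧ τ` times the rotation of `γ`. -/
theorem curv_eq {P : Fn} {ω τ γ : OneForm} (hP : SmoothFn P) (hω : SmoothForm ω)
    (hτ : SmoothForm τ) (hγ : SmoothForm γ) :
    curv P ω τ γ =
      (fun p => sectional P p * (ω.1 p * τ.2 p - ω.2 p * τ.1 p) * γ.2 p,
       fun p => -(sectional P p * (ω.1 p * τ.2 p - ω.2 p * τ.1 p) * γ.1 p)) := by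
  obtain ⟨w1, w2⟩ := ω
  obtain ⟨t1, t2⟩ := τ
  obtain ⟨c1, c2⟩ := γ
  obtain ⟨hw1, hw2⟩ := hω
  obtain ⟨ht1, ht2⟩ := hτ
  obtain ⟨hc1, hc2⟩ := hγ
  dsimp only at hw1 hw2 ht1 ht2 hc1 hc2
  unfold curv koszul dF PiForm
  ext p <;>
  · dsimp only [Dconn, sharpF, lieVF, sharpVF, sectional, Prod.fst_sub, Prod.snd_sub,
      Pi.sub_apply]
    simp (maxDischargeDepth := 12) only [SmoothFn.add, SmoothFn.sub, SmoothFn.neg,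
      SmoothFn.mul, SmoothFn.pd1, SmoothFn.pd2, SmoothFn.pd2_pd1, hP, hw1, hw2, ht1, ht2,
      hc1, hc2, pd1_add, pd1_sub, pd1_neg, pd1_mul, pd2_add, pd2_sub, pd2_neg, pd2_mul]
    ring

theorem curvature_pair_symmetry (Pi : Fn) (hPi : SmoothFn Pi) :
    (∀ ω τ γ δ : OneForm, SmoothForm ω → SmoothForm τ → SmoothForm γ → SmoothForm δ →
        gmet (curv Pi ω τ γ) δ = gmet (curv Pi γ δ ω) τ) ∧
    (∀ α η : OneForm, SmoothForm α → SmoothForm η →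
        gmet (curv Pi α η η) α = gmet (curv Pi η α α) η) := by
  have symm : ∀ ω τ γ δ : OneForm, SmoothForm ω → SmoothForm τ → SmoothForm γ →
      SmoothForm δ → gmet (curv Pi ω τ γ) δ = gmet (curv Pi γ δ ω) τ := by
    intro ω τ γ δ hω hτ hγ hδ
    rw [curv_eq hPi hω hτ hγ, curv_eq hPi hγ hδ hω]
    funext p
    simp only [gmet]
    ring
  exact ⟨symm, fun α η hα hη => symm α η η α hα hη hη hα⟩

end
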